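/- Characteristic polynomial of the transverse flux matrix: for every state Q = (ρ, ρu, ρv, ρw, ρθ) with ρ > 0 and θ > 0, det(λI − 𝒞(Q)) = (λ − v)³ · ((λ − v)² − c_s²/γ); in particular the eigenvalues of 𝒞(Q) are v − c_s/√γ, v (with multiplicity three), and v + c_s/√γ. -/

import Mathlib

open Matrix

/-- A root of `det (μ I - A)` is an eigenvalue of `A`. -/
theorem hasEigenvalue_toLin'_of_det_smul_one_sub_eq_zero {n K : Type*} [Fintype n] [DecidableEq n]
    [Field K] {A : Matrix n n K} {μ : K} (h : (μ • (1 : Matrix n n K) - A).det = 0) :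
    Module.End.HasEigenvalue (Matrix.toLin' A) μ := by
  obtain ⟨x, hx, hAx⟩ := Matrix.exists_mulVec_eq_zero_iff.mpr h
  refine Module.End.hasEigenvalue_of_hasEigenvector (x := x)
    ⟨Module.End.mem_eigenspace_iff.mpr ?_, hx⟩
  rw [Matrix.sub_mulVec, Matrix.smul_mulVec, Matrix.one_mulVec, sub_eq_zero] at hAx
  rw [Matrix.toLin'_apply, hAx]

/-- Characteristic polynomial of the transverse flux matrix:
`det (λ I − 𝒞(Q)) = (λ − v)³ ((λ − v)² − c_s²/γ)`; in particular
`v − c_s/√γ`, `v` and `v + c_s/√γ` are eigenvalues of `𝒞(Q)`. -/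
theorem transverse_flux_charpoly
    (C₀ γ ρ u v w θ cs : ℝ)
    (hC₀ : 0 < C₀) (hγ : 1 < γ) (hρ : 0 < ρ) (hθ : 0 < θ)
    (hcs : 0 < cs) (hcs2 : cs ^ 2 = C₀ * (ρ * θ) ^ (γ - 1) * γ * θ) :
    (∀ lam : ℝ,
      (lam • (1 : Matrix (Fin 5) (Fin 5) ℝ) -
        !![0,      0, 1,     0, 0;
           -(u*v), v, u,     0, 0;
           -(v^2), 0, 2*v,   0, cs^2/(γ*θ);
           -(w*v), 0, w,     v, 0;
           -(θ*v), 0, θ,     0, v]).det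
        = (lam - v)^3 * ((lam - v)^2 - cs^2/γ)) ∧
    (∀ μ ∈ ({v - cs / Real.sqrt γ, v, v + cs / Real.sqrt γ} : Set ℝ),
      Module.End.HasEigenvalue
        (Matrix.toLin'
          (!![0,      0, 1,     0, 0;
              -(u*v), v, u,     0, 0;
              -(v^2), 0, 2*v,   0, cs^2/(γ*θ);
              -(w*v), 0, w,     v, 0;
              -(θ*v), 0, θ,     0, v] : Matrix (Fin 5) (Fin 5) ℝ)) μ) := by
  have hγ₀ : 0 < γ := by linarith
  have charpoly (lam : ℝ) :
      (lam • (1 : Matrix (Fin 5) (Fin 5) ℝ) -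
        !![0,      0, 1,     0, 0;
           -(u*v), v, u,     0, 0;
           -(v^2), 0, 2*v,   0, cs^2/(γ*θ);
           -(w*v), 0, w,     v, 0;
           -(θ*v), 0, θ,     0, v]).det
        = (lam - v)^3 * ((lam - v)^2 - cs^2/γ) := by
    have hk : cs^2/γ = cs^2/(γ*θ) * θ := by field_simp
    rw [hk]
    generalize cs^2/(γ*θ) = k
    simp [Matrix.det_succ_row_zero, Fin.sum_univ_succ, Fin.succAbove, Matrix.one_apply]
    ring
  refine ⟨charpoly, fun μ hμ => hasEigenvalue_toLin'_of_det_smul_one_sub_eq_zero ?_⟩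
  rw [charpoly]
  have hs : (cs / √γ)^2 = cs^2/γ := by rw [div_pow, Real.sq_sqrt hγ₀.le]
  rw [← hs]
  rcases hμ with rfl | rfl | rfl <;> ring
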